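/- arXiv:2410.09830 — 4 statements merged into one kernel-verified Lean document; each statement's English description precedes it below -/
import Mathlib

section
/- Let p ≥ 1 be a real number, let G be a simple graph on n vertices, let e be an edge of G and H = G − e, and let λ_1 ≥ ⋯ ≥ λ_n and θ_1 ≥ ⋯ ≥ θ_n denote the eigenvalues of the adjacency matrices A(G) and A(H), respectively. If H has at least two positive eigenvalues, then E_p^+(G) ≥ E_p^+(H) + max{θ_2 − 1, 0}^p − θ_2^p. -/
open Polynomial

/-- Adjacency matrix of a simple graph over ℝ (using classical decidability). -/
noncomputable def adjMat {V : Type*} [Fintype V] (G : SimpleGraph V) : Matrix V V ℝ :=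
  letI := Classical.decRel G.Adj
  SimpleGraph.adjMatrix ℝ G

/-- Positive `p`-energy: the sum of the `p`-th powers of the positive eigenvalues of the
adjacency matrix. -/
noncomputable def posEnergy {V : Type*} [Fintype V] [DecidableEq V]
    (G : SimpleGraph V) (p : ℝ) : ℝ :=
  (((adjMat G).charpoly.roots.filter (fun x : ℝ => 0 < x)).map (fun x : ℝ => x ^ p)).sum

open Matrix in
lemma eigdata {n : ℕ} (M : Matrix (Fin n) (Fin n) ℝ) (hM : M.IsHermitian) :
    ∃ (a : Fin n → ℝ) (U : Matrix (Fin n) (Fin n) ℝ), Antitone a ∧ Uᵀ * U = 1 ∧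
      M = Uᵀ * diagonal a * U ∧ M.charpoly.roots = Finset.univ.val.map a := by
  classical
  set b := hM.eigenvalues with hb
  let σ : Equiv.Perm (Fin n) := Fin.revPerm.trans (Tuple.sort b)
  let W : Matrix (Fin n) (Fin n) ℝ := hM.eigenvectorUnitary
  have hW : W * Wᵀ = 1 := by
    have := (Matrix.mem_unitaryGroup_iff).1 hM.eigenvectorUnitary.2
    simpa [W, star_eq_conjTranspose, conjTranspose_eq_transpose_of_trivial] using this
  have hS : M = W * diagonal b * Wᵀ := by
    have := hM.spectral_theorem
    rw [Unitary.conjStarAlgAut_apply] at this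
    simpa [W, star_eq_conjTranspose, conjTranspose_eq_transpose_of_trivial, Function.comp_def, hb]
      using this
  refine ⟨b ∘ σ, (Wᵀ).submatrix σ id, ?_, ?_, ?_, ?_⟩
  · intro i j hij
    exact Tuple.monotone_sort b (Fin.rev_le_rev.2 hij)
  · rw [← hW, transpose_submatrix, transpose_transpose]
    rw [Matrix.submatrix_mul_equiv]; rfl
  · rw [transpose_submatrix, transpose_transpose, ← submatrix_diagonal_equiv,
      submatrix_mul_equiv, submatrix_mul_equiv, ← hS]; rfl
  · rw [hM.roots_charpoly_eq_eigenvalues]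
    rw [← Multiset.map_map, ← Finset.univ.val.map_map]
    have : (Finset.univ : Finset (Fin n)).val.map σ = Finset.univ.val := by
      have := congrArg Finset.val (Finset.map_univ_equiv σ)
      simpa using this
    rw [this]
    rw [Multiset.map_congr rfl (fun x _ => show (RCLike.ofReal x : ℝ) = x from rfl), Multiset.map_id']

lemma eq_of_roots {n : ℕ} (a b : Fin n → ℝ) (ha : Antitone a) (hb : Antitone b)
    (h : (Finset.univ.val.map a : Multiset ℝ) = Finset.univ.val.map b) : a = b := by
  apply List.ofFn_injective
  have hp : (List.ofFn a).Perm (List.ofFn b) := by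
    rw [Fin.univ_val_map, Fin.univ_val_map] at h
    exact Multiset.coe_eq_coe.1 h
  exact hp.eq_of_pairwise' ha.sortedGE_ofFn.pairwise hb.sortedGE_ofFn.pairwise

open Matrix in
lemma quad_eq {n : ℕ} (a : Fin n → ℝ) (U : Matrix (Fin n) (Fin n) ℝ) (x : Fin n → ℝ) :
    x ⬝ᵥ (Uᵀ * diagonal a * U) *ᵥ x = ∑ i, a i * (U *ᵥ x) i ^ 2 := by
  rw [← mulVec_mulVec, ← mulVec_mulVec, dotProduct_mulVec, vecMul_transpose, dotProduct]
  refine Finset.sum_congr rfl fun i _ => ?_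
  rw [mulVec_diagonal]; ring

open Matrix in
lemma norm_eq {n : ℕ} (U : Matrix (Fin n) (Fin n) ℝ) (hU : Uᵀ * U = 1) (x : Fin n → ℝ) :
    x ⬝ᵥ x = ∑ i, (U *ᵥ x) i ^ 2 := by
  have := quad_eq (fun _ => 1) U x
  simp only [one_mul] at this
  rw [← this]
  simp [hU]

open Matrix in
lemma weyl {n k : ℕ} (M M' : Matrix (Fin n) (Fin n) ℝ) (a b : Fin n → ℝ)
    (U V : Matrix (Fin n) (Fin n) ℝ) (ha : Antitone a) (hb : Antitone b)
    (hU : Uᵀ * U = 1) (hV : Vᵀ * V = 1) (hM : M = Uᵀ * diagonal a * U)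
    (hM' : M' = Vᵀ * diagonal b * V) (w : Fin k → Fin n → ℝ)
    (h : ∀ x, (∀ l, w l ⬝ᵥ x = 0) → x ⬝ᵥ M' *ᵥ x ≤ x ⬝ᵥ M *ᵥ x)
    (i j : Fin n) (hij : (i : ℕ) + k ≤ j) : b j ≤ a i := by
  let L : (Fin n → ℝ) →ₗ[ℝ] ((Set.Iio i → ℝ) × (Set.Ioi j → ℝ) × (Fin k → ℝ)) :=
    (LinearMap.funLeft ℝ ℝ Subtype.val ∘ₗ U.mulVecLin).prod
      ((LinearMap.funLeft ℝ ℝ Subtype.val ∘ₗ V.mulVecLin).prod (Matrix.of w).mulVecLin)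
  have hker : LinearMap.ker L ≠ ⊥ := by
    apply LinearMap.ker_ne_bot_of_finrank_lt
    simp
    omega
  obtain ⟨x, hx, hx0⟩ := (Submodule.ne_bot_iff _).mp hker
  have hx' : L x = 0 := hx
  have h1 : ∀ m, m < i → (U *ᵥ x) m = 0 := fun m hm =>
    congrFun (congrArg Prod.fst hx') ⟨m, hm⟩
  have h2 : ∀ m, j < m → (V *ᵥ x) m = 0 := fun m hm =>
    congrFun (congrArg (fun z => z.2.1) hx') ⟨m, hm⟩
  have h3 : ∀ l, w l ⬝ᵥ x = 0 := fun l => congrFun (congrArg (fun z => z.2.2) hx') l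
  have h4 := h x h3
  have hpos : 0 < x ⬝ᵥ x := by
    have h0 : 0 ≤ x ⬝ᵥ x := Finset.sum_nonneg fun i _ => mul_self_nonneg _
    exact lt_of_le_of_ne h0 fun h => hx0 (dotProduct_self_eq_zero.1 h.symm)
  have h5 : x ⬝ᵥ M *ᵥ x ≤ a i * (x ⬝ᵥ x) := by
    rw [hM, quad_eq, norm_eq U hU x, Finset.mul_sum]
    refine Finset.sum_le_sum fun m _ => ?_
    rcases lt_or_ge m i with hm | hm
    · simp [h1 m hm]
    · exact mul_le_mul_of_nonneg_right (ha hm) (sq_nonneg _)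
  have h6 : b j * (x ⬝ᵥ x) ≤ x ⬝ᵥ M' *ᵥ x := by
    rw [hM', quad_eq, norm_eq V hV x, Finset.mul_sum]
    refine Finset.sum_le_sum fun m _ => ?_
    rcases lt_or_ge j m with hm | hm
    · simp [h2 m hm]
    · exact mul_le_mul_of_nonneg_right (hb hm) (sq_nonneg _)
  exact le_of_mul_le_mul_right (by linarith) hpos

open Matrix in
lemma top_le {n : ℕ} (A B : Matrix (Fin n) (Fin n) ℝ) (a b : Fin n → ℝ)
    (U V : Matrix (Fin n) (Fin n) ℝ) (ha : Antitone a)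
    (hU : Uᵀ * U = 1) (hV : Vᵀ * V = 1) (hA : A = Uᵀ * diagonal a * U)
    (hB : B = Vᵀ * diagonal b * V) (hB0 : ∀ i j, 0 ≤ B i j) (hAB : ∀ i j, B i j ≤ A i j)
    (z : Fin n) (hz : ∀ i, z ≤ i) : b z ≤ a z := by
  have hV' : V * Vᵀ = 1 := mul_eq_one_comm.1 hV
  let y : Fin n → ℝ := Vᵀ *ᵥ Pi.single z 1
  have hVy : V *ᵥ y = Pi.single z 1 := by simp only [y]; rw [mulVec_mulVec, hV', one_mulVec]
  have h1 : y ⬝ᵥ B *ᵥ y = b z := by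
    rw [hB, quad_eq, hVy]
    simp [Pi.single_apply]
  have h2 : y ⬝ᵥ y = 1 := by
    rw [norm_eq V hV, hVy]
    simp [Pi.single_apply]
  let x : Fin n → ℝ := fun i => |y i|
  have h3 : x ⬝ᵥ x = 1 := by rw [← h2]; simp [dotProduct, x]
  have h4 : y ⬝ᵥ B *ᵥ y ≤ x ⬝ᵥ A *ᵥ x := by
    simp only [dotProduct, mulVec, Finset.mul_sum]
    refine Finset.sum_le_sum fun i _ => Finset.sum_le_sum fun j _ => ?_
    have e1 : y i * (B i j * y j) = B i j * (y i * y j) := by ring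
    have e2 : x i * (A i j * x j) = A i j * |y i * y j| := by simp only [x, abs_mul]; ring
    rw [e1, e2]
    exact (mul_le_mul_of_nonneg_left (le_abs_self _) (hB0 i j)).trans
      (mul_le_mul_of_nonneg_right (hAB i j) (abs_nonneg _))
  have h5 : x ⬝ᵥ A *ᵥ x ≤ a z * (x ⬝ᵥ x) := by
    rw [hA, quad_eq, norm_eq U hU x, Finset.mul_sum]
    exact Finset.sum_le_sum fun m _ => mul_le_mul_of_nonneg_right (ha (hz m)) (sq_nonneg _)
  rw [h3] at h5
  linarith

lemma convex_f {p : ℝ} (hp : 1 ≤ p) : ConvexOn ℝ Set.univ (fun x : ℝ => max x 0 ^ p) := by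
  refine ⟨convex_univ, fun x _ y _ s t hs ht hst => ?_⟩
  have h := (convexOn_rpow hp).2 (x := max x 0) (Set.mem_Ici.2 (le_max_right _ _))
    (y := max y 0) (Set.mem_Ici.2 (le_max_right _ _)) hs ht hst
  refine le_trans ?_ h
  simp only [smul_eq_mul]
  apply Real.rpow_le_rpow (le_max_right _ _) _ (by linarith)
  apply max_le
  · gcongr <;> exact le_max_left _ _
  · positivity

lemma mono_f {p : ℝ} (hp : 1 ≤ p) : Monotone (fun x : ℝ => max x 0 ^ p) := fun x y h =>
  Real.rpow_le_rpow (le_max_right _ _) (max_le_max_right _ h) (by linarith)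

lemma convex_shift {f : ℝ → ℝ} (hf : ConvexOn ℝ Set.univ f) {x y x' y' : ℝ} (h : x ≤ y)
    (hy : y ≤ y') (he : y' - x' = y - x) : f y - f x ≤ f y' - f x' := by
  rcases eq_or_lt_of_le (h.trans hy) with h0 | h0
  · have : x = y := by linarith
    have : x' = y' := by linarith
    subst_vars; simp
  · have hd : 0 < y' - x := by linarith
    have hx' : x' = y' - (y - x) := by linarith
    have Hc : ∀ x y s t : ℝ, 0 ≤ s → 0 ≤ t → s + t = 1 → f (s * x + t * y) ≤ s * f x + t * f y :=
      fun x y s t hs ht hst => hf.2 (Set.mem_univ x) (Set.mem_univ y) hs ht hst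
    have k1 := Hc x y' ((y' - y) / (y' - x))
      ((y - x) / (y' - x)) (div_nonneg (by linarith) hd.le) (div_nonneg (by linarith) hd.le)
      (by field_simp; ring)
    have k2 := Hc x y' ((y - x) / (y' - x))
      ((y' - y) / (y' - x)) (div_nonneg (by linarith) hd.le) (div_nonneg (by linarith) hd.le)
      (by field_simp; ring)
    rw [show (y' - y) / (y' - x) * x + (y - x) / (y' - x) * y' = y by field_simp; ring] at k1
    rw [show (y - x) / (y' - x) * x + (y' - y) / (y' - x) * y' = x' by
      rw [hx']; field_simp; ring] at k2
    have : (y' - y) / (y' - x) = 1 - (y - x) / (y' - x) := by field_simp; ring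
    rw [this] at k1 k2
    linarith

/-- The interlacing sum bound. -/
lemma sum_bound {f : ℝ → ℝ} (hf : ConvexOn ℝ Set.univ f) (θ μ : ℕ → ℝ) (n : ℕ)
    (h1 : ∀ i, i < n → μ i ≤ θ i) (h2 : ∀ i, i + 1 < n → θ (i + 1) ≤ μ i) (m : ℕ) (hm : m + 1 ≤ n) :
    ∑ i ∈ Finset.range m, (f (θ (i + 1)) - f (μ (i + 1))) ≤
      f (θ 1) - f (θ 1 - ∑ i ∈ Finset.range m, (θ (i + 1) - μ (i + 1))) := by
  induction m with
  | zero => simp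
  | succ m ih =>
    have key : θ (m + 1) ≤ θ 1 - ∑ i ∈ Finset.range m, (θ (i + 1) - μ (i + 1)) := by
      have : ∑ i ∈ Finset.range m, (θ (i + 1) - μ (i + 1)) ≤
          ∑ i ∈ Finset.range m, (θ (i + 1) - θ (i + 1 + 1)) := by
        refine Finset.sum_le_sum fun i hi => ?_
        have := h2 (i + 1) (by have := Finset.mem_range.1 hi; omega)
        linarith
      rw [Finset.sum_range_sub' (fun i => θ (i + 1))] at this
      simp only [zero_add] at this
      linarith
    have ih := ih (by omega)
    rw [Finset.sum_range_succ, Finset.sum_range_succ]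
    have := convex_shift hf (h1 (m + 1) (by omega)) key
      (x' := θ 1 - (∑ i ∈ Finset.range m, (θ (i + 1) - μ (i + 1)) + (θ (m + 1) - μ (m + 1))))
      (by ring)
    linarith

lemma posEnergy_eq {n : ℕ} {p : ℝ} (hp : 1 ≤ p) (G : SimpleGraph (Fin n)) (lam : ℕ → ℝ)
    (hlam : (adjMat G).charpoly.roots = (Multiset.range n).map lam) :
    posEnergy G p = ∑ i ∈ Finset.range n, max (lam i) 0 ^ p := by
  have hs : ∀ s : Multiset ℝ, ((s.filter (fun x : ℝ => 0 < x)).map (fun x : ℝ => x ^ p)).sum =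
      (s.map (fun x : ℝ => max x 0 ^ p)).sum := by
    intro s
    induction s using Multiset.induction_on with
    | empty => simp
    | cons x s ih =>
      by_cases hx : 0 < x
      · rw [Multiset.filter_cons_of_pos _ hx]
        simp [ih, max_eq_left hx.le]
      · rw [Multiset.filter_cons_of_neg _ hx]
        simp [ih, max_eq_right (not_lt.1 hx), Real.zero_rpow (show p ≠ 0 by linarith)]
  rw [posEnergy, hs, hlam, Multiset.map_map]
  rfl

lemma adjMat_apply {n : ℕ} (G : SimpleGraph (Fin n)) [DecidableRel G.Adj] (i j : Fin n) :
    adjMat G i j = if G.Adj i j then 1 else 0 := by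
  rw [adjMat, SimpleGraph.adjMatrix_apply]
  congr

lemma adjMat_herm {n : ℕ} (G : SimpleGraph (Fin n)) : (adjMat G).IsHermitian := by
  classical
  ext i j
  simp [adjMat_apply, G.adj_comm]

lemma roots_fin {n : ℕ} (lam : ℕ → ℝ) :
    (Multiset.range n).map lam = Finset.univ.val.map (fun i : Fin n => lam i) := by
  rw [Fin.univ_val_map]
  simp [Multiset.range, List.ofFn_eq_map]
  rw [← List.map_coe_finRange_eq_range, List.map_map]
  rfl

open Matrix in
/-- Let `p ≥ 1`, let `G` be a simple graph on `n` vertices, `e ∈ E(G)`,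
`H = G - e`, with `lam` and `θ` the nonincreasing lists of eigenvalues of `A(G)` and `A(H)`
(0-indexed, so `θ 1` is the second largest eigenvalue θ₂ of `H`). If `H` has at least two
positive eigenvalues, then `E_p^+(G) ≥ E_p^+(H) + max{θ₂ - 1, 0}^p - θ₂^p`. -/
theorem positive_p_energy_edge_deletion {n : ℕ} (p : ℝ) (hp : 1 ≤ p)
    (G H : SimpleGraph (Fin n)) (e : Sym2 (Fin n)) (he : e ∈ G.edgeSet)
    (hH : H = G.deleteEdges {e})
    (lam θ : ℕ → ℝ) (hlam_mono : Antitone lam) (hθ_mono : Antitone θ)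
    (hlam : (adjMat G).charpoly.roots = (Multiset.range n).map lam)
    (hθ : (adjMat H).charpoly.roots = (Multiset.range n).map θ)
    (hn : 2 ≤ n) (hpos : 0 < θ 1) :
    posEnergy G p ≥ posEnergy H p + max (θ 1 - 1) 0 ^ p - θ 1 ^ p := by
  classical
  obtain ⟨a, U, ha, hU, hA, hra⟩ := eigdata (adjMat G) (adjMat_herm G)
  obtain ⟨b, V, hb, hV, hB, hrb⟩ := eigdata (adjMat H) (adjMat_herm H)
  have hal : a = fun i : Fin n => lam i := by
    refine eq_of_roots _ _ ha (fun i j h => hlam_mono h) ?_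
    rw [← hra, hlam, roots_fin]
  have hbl : b = fun i : Fin n => θ i := by
    refine eq_of_roots _ _ hb (fun i j h => hθ_mono h) ?_
    rw [← hrb, hθ, roots_fin]
  induction e using Sym2.ind with
  | _ u v =>
  have huv : G.Adj u v := he
  have hne : u ≠ v := huv.ne
  set w : Fin n → ℝ := Pi.single u 1 - Pi.single v 1 with hw
  have hAH : adjMat G = adjMat H + (Matrix.single u v 1 + Matrix.single v u 1) := by
    ext i j
    simp only [Matrix.add_apply, adjMat_apply, hH, SimpleGraph.deleteEdges_adj, Matrix.single_apply,
      Set.mem_singleton_iff, Sym2.eq_iff]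
    by_cases h1 : u = i ∧ v = j
    · obtain ⟨rfl, rfl⟩ := h1
      simp [huv, hne, hne.symm]
    · by_cases h2 : v = i ∧ u = j
      · obtain ⟨rfl, rfl⟩ := h2
        simp [huv.symm, hne, hne.symm]
      · have h3 : ¬ (i = u ∧ j = v ∨ i = v ∧ j = u) := by
          rintro (⟨rfl, rfl⟩ | ⟨rfl, rfl⟩) <;> simp_all
        simp [h1, h2, h3]
  let C : Matrix (Fin n) (Fin n) ℝ := adjMat H - (1 / 2 : ℝ) • vecMulVec w w
  have hC : C.IsHermitian := by
    refine (adjMat_herm H).sub ?_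
    ext i j
    simp [vecMulVec_apply, mul_comm]
  obtain ⟨c, W, hc, hW, hCe, -⟩ := eigdata C hC
  have hqw : ∀ x, w ⬝ᵥ x = x u - x v := by
    intro x; simp [hw, sub_dotProduct]
  have hqC : ∀ x : Fin n → ℝ, x ⬝ᵥ C *ᵥ x = x ⬝ᵥ adjMat H *ᵥ x - 1 / 2 * (x u - x v) ^ 2 := by
    intro x
    simp only [C, sub_mulVec, smul_mulVec, vecMulVec_mulVec, dotProduct_sub, dotProduct_smul,
      dotProduct_comm x w, hqw, smul_eq_mul, op_smul_eq_smul]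
    ring
  have hqA : ∀ x : Fin n → ℝ, x ⬝ᵥ adjMat G *ᵥ x = x ⬝ᵥ adjMat H *ᵥ x + 2 * (x u * x v) := by
    intro x
    rw [hAH]
    simp only [add_mulVec, dotProduct_add, single_mulVec, dotProduct_single]
    simp [Function.update_apply, dotProduct, Finset.sum_ite_eq]
    ring
  -- interlacing facts
  have i1 : ∀ i : Fin n, c i ≤ a i := fun i =>
    weyl (k := 0) _ _ a c U W ha hc hU hW hA hCe (fun _ => 0)
      (fun x _ => by rw [hqC, hqA]; nlinarith [sq_nonneg (x u + x v)]) i i (by simp)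
  have i2 : ∀ i : Fin n, c i ≤ b i := fun i =>
    weyl (k := 0) _ _ b c V W hb hc hV hW hB hCe (fun _ => 0)
      (fun x _ => by rw [hqC]; nlinarith [sq_nonneg (x u - x v)]) i i (by simp)
  have i3 : ∀ i j : Fin n, (i : ℕ) + 1 ≤ j → b j ≤ c i := fun i j hij =>
    weyl (k := 1) _ _ c b W V hc hb hW hV hCe hB (fun _ => w)
      (fun x hx => by
        have := hx 0
        rw [hqw] at this
        rw [hqC, this]; simp) i j hij
  have i4 : b ⟨0, by omega⟩ ≤ a ⟨0, by omega⟩ :=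
    top_le _ _ a b U V ha hU hV hA hB
      (fun i j => by rw [adjMat_apply]; split_ifs <;> norm_num)
      (fun i j => by
        rw [hAH]
        simp only [Matrix.add_apply, Matrix.single_apply]
        split_ifs <;> norm_num) _ (fun i => Nat.zero_le _)
  have tr : ∀ (d : Fin n → ℝ) (T : Matrix (Fin n) (Fin n) ℝ), Tᵀ * T = 1 →
      (Tᵀ * diagonal d * T).trace = ∑ i, d i := by
    intro d T hT
    rw [Matrix.trace_mul_comm, ← Matrix.mul_assoc, mul_eq_one_comm.1 hT, Matrix.one_mul,
      Matrix.trace_diagonal]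
  have t1 : ∑ i, c i = ∑ i, b i - 1 := by
    rw [← tr c W hW, ← tr b V hV, ← hCe, ← hB]
    simp only [C, trace_sub, trace_smul, trace_vecMulVec, hqw]
    simp [hw, hne, hne.symm]
    norm_num
  let μ : ℕ → ℝ := fun i => if h : i < n then c ⟨i, h⟩ else 0
  have hμ : ∀ i (h : i < n), μ i = c ⟨i, h⟩ := fun i h => by simp [μ, h]
  obtain ⟨m, rfl⟩ : ∃ m, n = m + 1 := ⟨n - 1, by omega⟩
  have j1 : ∀ i, i < m + 1 → μ i ≤ lam i := fun i h => by
    rw [hμ i h]; simpa [hal] using i1 ⟨i, h⟩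
  have j2 : ∀ i, i < m + 1 → μ i ≤ θ i := fun i h => by
    rw [hμ i h]; simpa [hbl] using i2 ⟨i, h⟩
  have j3 : ∀ i, i + 1 < m + 1 → θ (i + 1) ≤ μ i := fun i h => by
    rw [hμ i (by omega)]; simpa [hbl] using i3 ⟨i, by omega⟩ ⟨i + 1, h⟩ le_rfl
  have j4 : θ 0 ≤ lam 0 := by simpa [hal, hbl] using i4
  have t2 : ∑ i ∈ Finset.range (m + 1), μ i = ∑ i ∈ Finset.range (m + 1), θ i - 1 := by
    rw [Finset.sum_range, Finset.sum_range]
    simp only [hbl] at t1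
    rw [← t1]
    exact Finset.sum_congr rfl fun i _ => hμ i i.2
  set f : ℝ → ℝ := fun x => max x 0 ^ p with hf
  have S := sum_bound (convex_f hp) θ μ (m + 1) j2 j3 m le_rfl
  rw [posEnergy_eq hp G lam hlam, posEnergy_eq hp H θ hθ]
  change ∑ i ∈ Finset.range (m + 1), f (lam i) ≥ ∑ i ∈ Finset.range (m + 1), f (θ i)
    + f (θ 1 - 1) - θ 1 ^ p
  have hf1 : θ 1 ^ p = f (θ 1) := by simp [f, max_eq_left hpos.le]
  rw [hf1]
  change ∑ i ∈ Finset.range m, (f (θ (i + 1)) - f (μ (i + 1))) ≤ f (θ 1) - f _ at S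
  rw [Finset.sum_range_succ', Finset.sum_range_succ' (fun i => f (θ i))]
  rw [Finset.sum_range_succ', Finset.sum_range_succ'] at t2
  have S1 : ∑ i ∈ Finset.range m, f (μ (i + 1)) ≤ ∑ i ∈ Finset.range m, f (lam (i + 1)) :=
    Finset.sum_le_sum fun i hi => mono_f hp (j1 _ (by have := Finset.mem_range.1 hi; omega))
  have S2 : f (θ 0) ≤ f (lam 0) := mono_f hp j4
  have S3 : f (θ 1 - 1) ≤ f (θ 1 - ∑ i ∈ Finset.range m, (θ (i + 1) - μ (i + 1))) := by
    apply mono_f hp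
    rw [Finset.sum_sub_distrib]
    have := j2 0 (by omega)
    linarith
  rw [Finset.sum_sub_distrib] at S
  linarith
end

section
/- Let p ≥ 1 be a real number, let G be a simple graph on n vertices, let e be an edge of G and H = G − e, and let λ_1 ≥ ⋯ ≥ λ_n and θ_1 ≥ ⋯ ≥ θ_n denote the eigenvalues of the adjacency matrices A(G) and A(H), respectively. If H has at least two negative eigenvalues, then E_p^-(G) ≥ E_p^-(H) + max{−θ_n − 1, 0}^p − |θ_n|^p. -/
open Polynomial

/-- Negative `p`-energy: the sum of the `p`-th powers of the absolute values of the negative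
eigenvalues of the adjacency matrix. -/
noncomputable def negEnergy {V : Type*} [Fintype V] [DecidableEq V]
    (G : SimpleGraph V) (p : ℝ) : ℝ :=
  (((adjMat G).charpoly.roots.filter (fun x : ℝ => x < 0)).map (fun x : ℝ => |x| ^ p)).sum

/-- The function `max(x,0)^p`. -/
noncomputable def pp (p x : ℝ) : ℝ := max x 0 ^ p

lemma pp_mono {p : ℝ} (hp : 1 ≤ p) {x y : ℝ} (h : x ≤ y) : pp p x ≤ pp p y := by
  unfold pp
  exact Real.rpow_le_rpow (le_max_right _ _) (max_le_max_right _ h) (by linarith)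

/-- A subgradient of `pp`. -/
noncomputable def ppd (p x : ℝ) : ℝ := if x ≤ 0 then 0 else p * x ^ (p - 1)

lemma ppd_nonneg {p : ℝ} (hp : 1 ≤ p) (x : ℝ) : 0 ≤ ppd p x := by
  unfold ppd
  split_ifs with h
  · exact le_rfl
  · push Not at h
    positivity

lemma ppd_mono {p : ℝ} (hp : 1 ≤ p) {x y : ℝ} (h : x ≤ y) : ppd p x ≤ ppd p y := by
  by_cases hx : x ≤ 0
  · have : ppd p x = 0 := by simp [ppd, hx]
    rw [this]
    exact ppd_nonneg hp y
  · have hy : ¬ y ≤ 0 := by linarith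
    simp only [ppd, hx, hy, if_false]
    push Not at hx
    exact mul_le_mul_of_nonneg_left (Real.rpow_le_rpow hx.le h (by linarith)) (by linarith)

lemma pp_tangent {p : ℝ} (hp : 1 ≤ p) (a b : ℝ) :
    pp p b + ppd p b * (a - b) ≤ pp p a := by
  by_cases hb : b ≤ 0
  · have h1 : ppd p b = 0 := by simp [ppd, hb]
    have h2 : pp p b = 0 := by
      simp only [pp, max_eq_right hb]
      exact Real.zero_rpow (by linarith)
    rw [h1, h2]
    have : 0 ≤ pp p a := Real.rpow_nonneg (le_max_right _ _) _
    linarith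
  · have h1 : ppd p b = p * b ^ (p - 1) := by simp [ppd, hb]
    push Not at hb
    have h2 : pp p b = b ^ p := by simp only [pp, max_eq_left hb.le]
    have hd : 0 ≤ p * b ^ (p - 1) := by positivity
    rw [h1, h2]
    have hbp : b ^ p = b ^ (p - 1) * b := by
      rw [← Real.rpow_add_one hb.ne']; congr 1; ring
    set A := max a 0 with hA
    have hA0 : 0 ≤ A := le_max_right _ _
    have haA : a ≤ A := le_max_left _ _
    have hB := one_add_mul_self_le_rpow_one_add (s := A / b - 1)
      (by have : 0 ≤ A / b := by positivity
          linarith) hp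
    have h3 : (1 + (A / b - 1)) ^ p = A ^ p / b ^ p := by
      rw [← Real.div_rpow hA0 hb.le]; congr 1; ring
    rw [h3] at hB
    have hbp0 : 0 < b ^ p := by positivity
    rw [le_div_iff₀ hbp0] at hB
    have h4 : (1 + p * (A / b - 1)) * b ^ p = b ^ p + p * b ^ (p - 1) * (A - b) := by
      rw [hbp]; field_simp
    rw [h4] at hB
    have h5 : p * b ^ (p - 1) * (a - b) ≤ p * b ^ (p - 1) * (A - b) :=
      mul_le_mul_of_nonneg_left (by linarith) hd
    simp only [pp]
    linarith

/-- Abel summation inequality. -/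
lemma abel_nonneg (n : ℕ) (c d : ℕ → ℝ) (hc : Antitone c) (hc0 : ∀ i, 0 ≤ c i)
    (hd : ∀ j ≤ n, 0 ≤ ∑ i ∈ Finset.range j, d i) :
    0 ≤ ∑ i ∈ Finset.range n, c i * d i := by
  have key : ∀ j ≤ n, c j * ∑ i ∈ Finset.range j, d i ≤ ∑ i ∈ Finset.range j, c i * d i := by
    intro j
    induction j with
    | zero => simp
    | succ j ih =>
      intro hj
      rw [Finset.sum_range_succ (fun i => c i * d i)]
      have h1 := ih (by omega)
      have h2 := hd (j + 1) hj
      have h3 := hc (Nat.le_succ j)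
      have h4 := mul_le_mul_of_nonneg_right h3 h2
      simp only [Nat.succ_eq_add_one] at h4
      rw [Finset.sum_range_succ] at h4 ⊢
      nlinarith
  exact (mul_nonneg (hc0 n) (hd n le_rfl)).trans (key n le_rfl)

lemma karamata {p : ℝ} (hp : 1 ≤ p) (n : ℕ) (a b : ℕ → ℝ) (hb : Antitone b)
    (h : ∀ j ≤ n, ∑ i ∈ Finset.range j, b i ≤ ∑ i ∈ Finset.range j, a i) :
    ∑ i ∈ Finset.range n, pp p (b i) ≤ ∑ i ∈ Finset.range n, pp p (a i) := by
  have h1 := abel_nonneg n (fun i => ppd p (b i)) (fun i => a i - b i)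
    (fun i j hij => ppd_mono hp (hb hij)) (fun i => ppd_nonneg hp _)
    (fun j hj => by rw [Finset.sum_sub_distrib]; linarith [h j hj])
  have h2 : ∑ i ∈ Finset.range n, (pp p (b i) + ppd p (b i) * (a i - b i)) ≤
      ∑ i ∈ Finset.range n, pp p (a i) :=
    Finset.sum_le_sum (fun i _ => pp_tangent hp _ _)
  rw [Finset.sum_add_distrib] at h2
  linarith

lemma insert_telescope (t : ℕ → ℝ) (ht : Antitone t) (c : ℝ) (hc : c ≤ t 0) (f : ℝ → ℝ) (j : ℕ) :
    ∑ i ∈ Finset.range j, f (max (t (i + 1)) (min (t i) c)) =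
      f c + ∑ i ∈ Finset.range j, f (t (i + 1)) - f (min (t j) c) := by
  induction j with
  | zero => simp [min_eq_right hc]
  | succ j ih =>
    rw [Finset.sum_range_succ, Finset.sum_range_succ, ih]
    have h := ht (Nat.le_succ j)
    simp only [Nat.succ_eq_add_one] at h
    rcases le_total (t (j + 1)) c with h1 | h1
    · rw [min_eq_left h1, max_eq_right (le_min h h1)]; ring
    · rw [min_eq_right h1, min_eq_right (h1.trans h), max_eq_left h1]; ring

lemma numeric {p : ℝ} (hp : 1 ≤ p) (n : ℕ) (hn : 1 ≤ n) (a t : ℕ → ℝ) (ht : Antitone t)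
    (htn : t n ≤ t 0 - 1) (hI : ∀ i, i + 1 < n → t (i + 1) ≤ a i)
    (hK : ∀ j ≤ n, 1 ≤ j → ∑ i ∈ Finset.range j, t i - 1 ≤ ∑ i ∈ Finset.range j, a i) :
    ∑ i ∈ Finset.range n, pp p (t i) + pp p (t 0 - 1) - pp p (t 0) ≤
      ∑ i ∈ Finset.range n, pp p (a i) := by
  set c := t 0 - 1 with hc
  have hc0 : c ≤ t 0 := by linarith
  have hk := karamata hp n a (fun i => max (t (i + 1)) (min (t i) c)) ?_ ?_
  · rw [insert_telescope t ht c hc0 (pp p) n, min_eq_left htn] at hk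
    have h1 := Finset.sum_range_succ (fun i => pp p (t i)) n
    rw [Finset.sum_range_succ'] at h1
    linarith
  · apply antitone_nat_of_succ_le
    intro i
    refine max_le ?_ ((min_le_left _ _).trans (le_max_left _ _))
    exact (ht (Nat.le_succ (i + 1))).trans (le_max_left _ _)
  · intro j hj
    rcases Nat.eq_zero_or_pos j with rfl | hj0
    · simp
    have h0 := insert_telescope t ht c hc0 (fun x => x) j
    rw [h0]
    rcases le_or_gt (t j) c with h1 | h1
    · rw [min_eq_left h1]
      have h2 := Finset.sum_range_succ t j
      rw [Finset.sum_range_succ'] at h2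
      linarith [hK j hj hj0]
    · rw [min_eq_right h1.le]
      have hjn : j ≠ n := by rintro rfl; linarith
      have : ∑ i ∈ Finset.range j, t (i + 1) ≤ ∑ i ∈ Finset.range j, a i :=
        Finset.sum_le_sum (fun i hi => hI i (by have := Finset.mem_range.1 hi; omega))
      linarith

section spectral

variable {n : ℕ}

local notation "EE" => EuclideanSpace ℝ (Fin n)

lemma weighted_le (a q : ℕ → ℝ) (n j : ℕ) (hj : j ≤ n) (ha : Antitone a)
    (hq0 : ∀ i < n, 0 ≤ q i) (hq1 : ∀ i < n, q i ≤ 1)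
    (hs : ∑ i ∈ Finset.range n, q i = j) :
    ∑ i ∈ Finset.range n, a i * q i ≤ ∑ i ∈ Finset.range j, a i := by
  have h1 : ∑ i ∈ Finset.range n, (a i - a j) * q i ≤
      ∑ i ∈ Finset.range n, (if i < j then a i - a j else 0) := by
    refine Finset.sum_le_sum (fun i hi => ?_)
    have hi := Finset.mem_range.1 hi
    split_ifs with h
    · have := ha h.le
      nlinarith [hq1 i hi]
    · have := ha (not_lt.1 h)
      nlinarith [hq0 i hi]
  have h2 : ∑ i ∈ Finset.range n, (if i < j then a i - a j else 0) =
      ∑ i ∈ Finset.range j, (a i - a j) := by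
    rw [← Finset.sum_filter]
    congr 1
    ext i
    simp only [Finset.mem_filter, Finset.mem_range]
    omega
  rw [h2] at h1
  simp only [sub_mul, Finset.sum_sub_distrib, ← Finset.mul_sum, hs, Finset.sum_const,
    Finset.card_range, nsmul_eq_mul] at h1
  linarith

lemma kyfan (w u : OrthonormalBasis (Fin n) ℝ EE) (a t : ℕ → ℝ) (ha : Antitone a)
    (x : EE) (hx : ‖x‖ ^ 2 ≤ 2)
    (h : ∀ v : EE, ∑ i : Fin n, t i * inner ℝ (u i) v ^ 2 ≤
      ∑ i : Fin n, a i * inner ℝ (w i) v ^ 2 + 1 / 2 * inner ℝ x v ^ 2)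
    (j : ℕ) (hj : j ≤ n) :
    ∑ i ∈ Finset.range j, t i - 1 ≤ ∑ i ∈ Finset.range j, a i := by
  classical
  let s : Finset (Fin n) := Finset.univ.filter (fun k => (k : ℕ) < j)
  have hsum : ∀ f : ℕ → ℝ, ∑ k ∈ s, f k = ∑ i ∈ Finset.range j, f i := by
    intro f
    simp only [s, Finset.sum_filter]
    rw [Fin.sum_univ_eq_sum_range (fun i => if i < j then f i else 0) n, ← Finset.sum_filter]
    congr 1
    ext i
    simp only [Finset.mem_filter, Finset.mem_range]
    omega
  have hk : ∀ k : Fin n, t k ≤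
      ∑ i : Fin n, a i * inner ℝ (w i) (u k) ^ 2 + 1 / 2 * inner ℝ x (u k) ^ 2 := by
    intro k
    have := h (u k)
    have h2 : ∑ i : Fin n, t i * inner ℝ (u i) (u k) ^ 2 = t k := by
      simp [orthonormal_iff_ite.1 u.orthonormal]
    rwa [h2] at this
  have hs := Finset.sum_le_sum (s := s) (fun k _ => hk k)
  rw [hsum t, Finset.sum_add_distrib, ← Finset.mul_sum, Finset.sum_comm] at hs
  simp only [← Finset.mul_sum] at hs
  have hb : ∀ y : EE, ∑ k ∈ s, inner ℝ y (u k) ^ 2 ≤ ‖y‖ ^ 2 := by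
    intro y
    have := u.orthonormal.sum_inner_products_le (s := s) y
    simpa [real_inner_comm] using this
  let q : ℕ → ℝ := fun i => if hi : i < n then ∑ k ∈ s, inner ℝ (w ⟨i, hi⟩) (u k) ^ 2 else 0
  have hq : ∀ i : Fin n, ∑ k ∈ s, inner ℝ (w i) (u k) ^ 2 = q i := by
    intro i; simp [q]
  simp only [hq] at hs
  rw [Fin.sum_univ_eq_sum_range (fun i => a i * q i) n] at hs
  have hw := weighted_le a q n j hj ha ?_ ?_ ?_
  · linarith [hb x]
  · intro i hi
    simp only [q, hi, dite_true]
    exact Finset.sum_nonneg (fun _ _ => sq_nonneg _)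
  · intro i hi
    simp only [q, hi, dite_true]
    refine (hb _).trans ?_
    simp
  · rw [← Fin.sum_univ_eq_sum_range]
    simp only [← hq]
    rw [Finset.sum_comm]
    have : ∀ k ∈ s, ∑ i : Fin n, inner ℝ (w i) (u k) ^ 2 = (1 : ℝ) := by
      intro k _
      rw [w.sum_sq_inner_right]
      simp
    rw [Finset.sum_congr rfl this]
    have := hsum (fun _ => 1)
    simpa using this

lemma weyl_s1 (w u : OrthonormalBasis (Fin n) ℝ EE) (a t : ℕ → ℝ) (ha : Antitone a) (ht : Antitone t)
    (x : EE)
    (h : ∀ v : EE, ∑ i : Fin n, t i * inner ℝ (u i) v ^ 2 ≤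
      ∑ i : Fin n, a i * inner ℝ (w i) v ^ 2 + 1 / 2 * inner ℝ x v ^ 2)
    (j : ℕ) (hj : j + 1 < n) : t (j + 1) ≤ a j := by
  classical
  let z : Fin (n - 1) → EE := fun i =>
    if (i : ℕ) < j then w ⟨i, by omega⟩ else if (i : ℕ) = j then x else u ⟨i + 1, by omega⟩
  let F : EE →ₗ[ℝ] (Fin (n - 1) → ℝ) := LinearMap.pi (fun i => innerₛₗ ℝ (z i))
  have hF : LinearMap.ker F ≠ ⊥ := LinearMap.ker_ne_bot_of_finrank_lt (by simp; omega)
  obtain ⟨v, hv, hv0⟩ := Submodule.exists_mem_ne_zero_of_ne_bot hF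
  have hz : ∀ i, inner ℝ (z i) v = 0 := by
    intro i
    have := congrFun (LinearMap.mem_ker.1 hv) i
    simpa [F] using this
  have hw : ∀ i : Fin n, (i : ℕ) < j → inner ℝ (w i) v = 0 := by
    intro i hi
    have := hz ⟨i, by omega⟩
    simpa [z, hi] using this
  have hxv : inner ℝ x v = 0 := by
    have := hz ⟨j, by omega⟩
    simpa [z] using this
  have hu : ∀ i : Fin n, j + 1 < (i : ℕ) → inner ℝ (u i) v = 0 := by
    intro i hi
    have := hz ⟨i - 1, by omega⟩
    have e1 : ¬ ((i : ℕ) - 1 < j) := by omega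
    have e2 : ¬ ((i : ℕ) - 1 = j) := by omega
    have e3 : (i : ℕ) - 1 + 1 = i := by omega
    simpa [z, e1, e2, e3] using this
  have h1 : t (j + 1) * ‖v‖ ^ 2 ≤ ∑ i : Fin n, t i * inner ℝ (u i) v ^ 2 := by
    rw [← u.sum_sq_inner_right v, Finset.mul_sum]
    refine Finset.sum_le_sum (fun i _ => ?_)
    by_cases hi : j + 1 < (i : ℕ)
    · simp [hu i hi]
    · exact mul_le_mul_of_nonneg_right (ht (not_lt.1 hi)) (sq_nonneg _)
  have h2 : ∑ i : Fin n, a i * inner ℝ (w i) v ^ 2 ≤ a j * ‖v‖ ^ 2 := by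
    rw [← w.sum_sq_inner_right v, Finset.mul_sum]
    refine Finset.sum_le_sum (fun i _ => ?_)
    by_cases hi : (i : ℕ) < j
    · simp [hw i hi]
    · exact mul_le_mul_of_nonneg_right (ha (not_lt.1 hi)) (sq_nonneg _)
  have h3 := h v
  rw [hxv] at h3
  have hpos : 0 < ‖v‖ ^ 2 := by positivity
  have : t (j + 1) * ‖v‖ ^ 2 ≤ a j * ‖v‖ ^ 2 := by linarith
  exact le_of_mul_le_mul_right this hpos

lemma eigen_basis (A : Matrix (Fin n) (Fin n) ℝ) (hA : A.IsHermitian) (lam : ℕ → ℝ)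
    (hm : Antitone lam) (hr : A.charpoly.roots = (Multiset.range n).map lam) :
    ∃ w : OrthonormalBasis (Fin n) ℝ EE, ∀ v : EE,
      (v.ofLp ⬝ᵥ A.mulVec v.ofLp) = ∑ i : Fin n, lam (n - 1 - i) * inner ℝ (w i) v ^ 2 := by
  classical
  have hperm : ∃ σ : Equiv.Perm (Fin n), ∀ i, hA.eigenvalues (σ i) = lam (n - 1 - i) := by
    refine ⟨Tuple.sort hA.eigenvalues, ?_⟩
    set σ := Tuple.sort hA.eigenvalues
    have h1 : Monotone (hA.eigenvalues ∘ σ) := Tuple.monotone_sort _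
    have h2 : Monotone (fun i : Fin n => lam (n - 1 - i)) := by
      intro i k hik
      apply hm
      have : (i : ℕ) ≤ k := hik
      omega
    have h3 : List.Perm (List.ofFn (hA.eigenvalues ∘ σ))
        (List.ofFn (fun i : Fin n => lam (n - 1 - i))) := by
      refine (Equiv.Perm.ofFn_comp_perm σ _).trans ?_
      have h4 : List.Perm (List.ofFn (fun i : Fin n => lam (n - 1 - i)))
          (List.ofFn (fun i : Fin n => lam i)) := by
        have := Equiv.Perm.ofFn_comp_perm (Fin.revPerm (n := n)) (fun i : Fin n => lam i)
        convert this using 2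
        funext i
        simp only [Function.comp, Fin.revPerm_apply, Fin.val_rev]
        congr 1
        omega
      refine List.Perm.trans ?_ h4.symm
      rw [← Multiset.coe_eq_coe]
      have h5 := hA.roots_charpoly_eq_eigenvalues
      rw [hr, Fin.univ_val_map] at h5
      have h6 : (Multiset.range n).map lam = (List.ofFn (fun i : Fin n => lam i) : Multiset ℝ) := by
        rw [← Multiset.coe_range, Multiset.map_coe, ← List.map_coe_finRange_eq_range, List.map_map,
          List.ofFn_eq_map]
        rfl
      rw [← h6, h5]
      rfl
    have h7 : List.ofFn (hA.eigenvalues ∘ σ) = List.ofFn (fun i : Fin n => lam (n - 1 - i)) :=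
      h3.eq_of_sortedLE h1.sortedLE_ofFn h2.sortedLE_ofFn
    exact fun i => congrFun (List.ofFn_injective h7) i
  obtain ⟨σ, hσ⟩ := hperm
  refine ⟨hA.eigenvectorBasis.reindex σ.symm, fun v => ?_⟩
  set w := hA.eigenvectorBasis with hw
  have hs := Matrix.isSymmetric_toEuclideanLin_iff.mpr hA
  have e1 : (v.ofLp ⬝ᵥ A.mulVec v.ofLp) = inner ℝ v (Matrix.toEuclideanLin A v) := by
    rw [EuclideanSpace.inner_eq_star_dotProduct, dotProduct_comm]
    simp
  have e2 : ∀ i, inner ℝ (w i) (Matrix.toEuclideanLin A v) = hA.eigenvalues i * inner ℝ (w i) v := by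
    intro i
    rw [← hs (w i) v]
    have : Matrix.toEuclideanLin A (w i) = hA.eigenvalues i • w i := by
      apply WithLp.ofLp_injective
      have := hA.mulVec_eigenvectorBasis i
      simpa using this
    rw [this, inner_smul_left]
    simp
  rw [e1, ← w.sum_inner_mul_inner, ← Equiv.sum_comp σ]
  refine Finset.sum_congr rfl (fun i _ => ?_)
  rw [e2, ← hσ]
  simp only [OrthonormalBasis.reindex_apply, Equiv.symm_symm, real_inner_comm]
  ring

end spectral

lemma negEnergy_eq {n : ℕ} (G : SimpleGraph (Fin n)) {p : ℝ} (hp : 1 ≤ p) (lam : ℕ → ℝ)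
    (hr : (adjMat G).charpoly.roots = (Multiset.range n).map lam) :
    negEnergy G p = ∑ i ∈ Finset.range n, pp p (-lam (n - 1 - i)) := by
  rw [Finset.sum_range_reflect (fun i => pp p (-lam i)) n]
  unfold negEnergy
  rw [hr, Multiset.filter_map, Multiset.map_map]
  change ∑ i ∈ (Finset.range n).filter (fun i => lam i < 0), |lam i| ^ p = _
  rw [Finset.sum_filter]
  refine Finset.sum_congr rfl (fun i _ => ?_)
  unfold pp
  split_ifs with h
  · rw [abs_of_neg h, max_eq_left (by linarith)]
  · rw [max_eq_right (by linarith), Real.zero_rpow (by linarith)]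

lemma adj_quad {n : ℕ} (G H : SimpleGraph (Fin n)) (e : Sym2 (Fin n)) (he : e ∈ G.edgeSet)
    (hH : H = G.deleteEdges {e}) : ∃ x : EuclideanSpace ℝ (Fin n), ‖x‖ ^ 2 ≤ 2 ∧
      ∀ v : EuclideanSpace ℝ (Fin n), (v.ofLp ⬝ᵥ (adjMat G).mulVec v.ofLp) ≤
        (v.ofLp ⬝ᵥ (adjMat H).mulVec v.ofLp) + 1 / 2 * inner ℝ x v ^ 2 := by
  classical
  induction e using Sym2.ind with
  | _ k l =>
  have hkl : G.Adj k l := he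
  have hne : k ≠ l := hkl.ne
  refine ⟨EuclideanSpace.single k 1 + EuclideanSpace.single l 1, ?_, fun v => ?_⟩
  · rw [norm_add_sq_real]
    simp [EuclideanSpace.inner_single_left, hne]
    norm_num
  · have hM : adjMat G = adjMat H + (Matrix.single k l 1 + Matrix.single l k 1) := by
      subst hH
      ext i j
      simp only [adjMat, SimpleGraph.adjMatrix_apply, Matrix.add_apply, Matrix.single_apply,
        SimpleGraph.deleteEdges_adj, Set.mem_singleton_iff, Sym2.eq_iff]
      by_cases h1 : i = k ∧ j = l
      · obtain ⟨rfl, rfl⟩ := h1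
        simp [hkl, hne]
      · by_cases h2 : i = l ∧ j = k
        · obtain ⟨rfl, rfl⟩ := h2
          simp [hkl.symm, hne]
        · have h1' : ¬ (k = i ∧ l = j) := fun h => h1 ⟨h.1.symm, h.2.symm⟩
          have h2' : ¬ (l = i ∧ k = j) := fun h => h2 ⟨h.1.symm, h.2.symm⟩
          simp [h1, h2, h1', h2']
    rw [hM, Matrix.add_mulVec, Matrix.add_mulVec, dotProduct_add, dotProduct_add]
    have e1 : ∀ a b : Fin n, v.ofLp ⬝ᵥ (Matrix.single a b (1 : ℝ)).mulVec v.ofLp = v a * v b := by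
      intro a b
      have h : Function.update (0 : Fin n → ℝ) a (v.ofLp b) = Pi.single a (v.ofLp b) := rfl
      simp [Matrix.single_mulVec, h]
    rw [e1, e1, inner_add_left]
    simp only [EuclideanSpace.inner_single_left, map_one, one_mul]
    nlinarith [sq_nonneg (v k - v l)]

/-- Let `p ≥ 1`, let `G` be a simple graph on `n` vertices, `e ∈ E(G)`,
`H = G - e`, with `lam` and `θ` the nonincreasing lists of eigenvalues of `A(G)` and `A(H)`
(0-indexed, so `θ (n-1)` is the smallest eigenvalue θₙ of `H`, and `θ (n-2) < 0` says that `H`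
has at least two negative eigenvalues). Then
`E_p^-(G) ≥ E_p^-(H) + max{-θₙ - 1, 0}^p - |θₙ|^p`. -/
theorem negative_p_energy_edge_deletion {n : ℕ} (p : ℝ) (hp : 1 ≤ p)
    (G H : SimpleGraph (Fin n)) (e : Sym2 (Fin n)) (he : e ∈ G.edgeSet)
    (hH : H = G.deleteEdges {e})
    (lam θ : ℕ → ℝ) (hlam_mono : Antitone lam) (hθ_mono : Antitone θ)
    (hlam : (adjMat G).charpoly.roots = (Multiset.range n).map lam)
    (hθ : (adjMat H).charpoly.roots = (Multiset.range n).map θ)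
    (hn : 2 ≤ n) (hneg : θ (n - 2) < 0) :
    negEnergy G p ≥ negEnergy H p + max (-θ (n - 1) - 1) 0 ^ p - |θ (n - 1)| ^ p := by
  rw [negEnergy_eq G hp lam hlam, negEnergy_eq H hp θ hθ]
  obtain ⟨x, hx, hq⟩ := adj_quad G H e he hH
  obtain ⟨w, hw⟩ := eigen_basis _ (adjMat_herm G) lam hlam_mono hlam
  obtain ⟨u, hu⟩ := eigen_basis _ (adjMat_herm H) θ hθ_mono hθ
  set a : ℕ → ℝ := fun i => -lam (n - 1 - i) with ha_def
  set t : ℕ → ℝ := fun i => -θ (n - 1 - i) with ht_def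
  have ha : Antitone a := fun i j hij => neg_le_neg (hlam_mono (by omega))
  have ht : Antitone t := fun i j hij => neg_le_neg (hθ_mono (by omega))
  have h : ∀ v : EuclideanSpace ℝ (Fin n), ∑ i : Fin n, t i * inner ℝ (u i) v ^ 2 ≤
      ∑ i : Fin n, a i * inner ℝ (w i) v ^ 2 + 1 / 2 * inner ℝ x v ^ 2 := by
    intro v
    have := hq v
    rw [hw, hu] at this
    simp only [ha_def, ht_def, neg_mul, Finset.sum_neg_distrib]
    linarith
  have hI := weyl_s1 w u a t ha ht x h
  have hK := kyfan w u a t ha x hx h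
  -- modify `t` beyond the end
  let t' : ℕ → ℝ := fun i => if i < n then t i else min (t i) (t 0 - 1)
  have ht' : Antitone t' := by
    intro i j hij
    have h1 := ht hij
    simp only [t']
    split_ifs with h2 h3 h3
    · exact h1
    · omega
    · exact (min_le_left _ _).trans h1
    · exact min_le_min_right _ h1
  have e0 : t' 0 = t 0 := by simp [t', show 0 < n by omega]
  have eS : ∀ i < n, t' i = t i := fun i hi => by simp [t', hi]
  have hnum := numeric hp n (by omega) a t' ht' (by rw [e0]; simp [t'])
    (fun i hi => by rw [eS _ hi]; exact hI i hi)
    (fun j hj _ => by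
      rw [Finset.sum_congr rfl (fun i hi => eS i (by have := Finset.mem_range.1 hi; omega))]
      exact hK j hj)
  rw [e0, Finset.sum_congr rfl (fun i hi => by rw [eS i (Finset.mem_range.1 hi)])] at hnum
  have hθn : θ (n - 1) < 0 := (hθ_mono (by omega)).trans_lt hneg
  have f0 : t 0 = -θ (n - 1) := by simp [ht_def]
  have f1 : pp p (t 0) = |θ (n - 1)| ^ p := by
    rw [f0, abs_of_neg hθn, pp, max_eq_left (by linarith)]
  rw [f1, f0] at hnum
  exact hnum
end

section
/- Let G be a simple graph on n vertices, let e be an edge of G and H = G − e, and let λ_1 ≥ ⋯ ≥ λ_n and θ_1 ≥ ⋯ ≥ θ_n denote the eigenvalues of the adjacency matrices A(G) and A(H), respectively. If H has at least two negative eigenvalues, then s^-(G) ≥ s^-(H) − θ_n^2 when θ_n > −1, and s^-(G) ≥ s^-(H) + 2θ_n + 1 when θ_n ≤ −1. -/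
open Polynomial

/-- Negative square energy: the sum of the squares of the negative adjacency eigenvalues. -/
noncomputable def sMinus {V : Type*} [Fintype V] [DecidableEq V] (G : SimpleGraph V) : ℝ :=
  (((adjMat G).charpoly.roots.filter (fun x : ℝ => x < 0)).map (fun x : ℝ => x ^ 2)).sum

/-- The negative-part square of a real number. -/
noncomputable def nsq (t : ℝ) : ℝ := (max (-t) 0) ^ 2

lemma filter_sum_eq (s : Multiset ℝ) :
    ((s.filter (fun x : ℝ => x < 0)).map (fun x : ℝ => x ^ 2)).sum = (s.map nsq).sum := by
  induction s using Multiset.induction_on with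
  | empty => simp
  | cons a s ih =>
    by_cases h : a < 0
    · rw [Multiset.filter_cons_of_pos (p := fun x : ℝ => x < 0) _ h, Multiset.map_cons, Multiset.map_cons,
        Multiset.sum_cons, Multiset.sum_cons, ih, nsq, max_eq_left (by linarith)]
      ring
    · rw [Multiset.filter_cons_of_neg (p := fun x : ℝ => x < 0) _ h, Multiset.map_cons, Multiset.sum_cons, ih, nsq,
        max_eq_right (by linarith)]
      ring

open Matrix in
lemma real_diag {V : Type*} [Fintype V] [DecidableEq V] (A : Matrix V V ℝ)
    (hA : A.IsHermitian) :
    ∃ (U : Matrix V V ℝ) (d : V → ℝ), U * Uᵀ = 1 ∧ Uᵀ * U = 1 ∧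
      A = U * diagonal d * Uᵀ ∧ A.charpoly.roots = Finset.univ.val.map d := by
  refine ⟨hA.eigenvectorUnitary, hA.eigenvalues, ?_, ?_, ?_, ?_⟩
  · have := (Matrix.mem_unitaryGroup_iff).1 hA.eigenvectorUnitary.2
    simpa [star_eq_conjTranspose] using this
  · have := (Matrix.mem_unitaryGroup_iff').1 hA.eigenvectorUnitary.2
    simpa [star_eq_conjTranspose] using this
  · have := hA.spectral_theorem
    rw [Unitary.conjStarAlgAut_apply] at this
    conv_lhs => rw [this]
    simp [star_eq_conjTranspose]
  · have := hA.roots_charpoly_eq_eigenvalues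
    simpa using this

open Matrix in
lemma lower_bound {V : Type*} [Fintype V] [DecidableEq V] (B Y : Matrix V V ℝ)
    (hB : B.IsHermitian) (hY : Y.PosSemidef) :
    -2 * (B * Y).trace - (Y * Y).trace ≤ (B.charpoly.roots.map nsq).sum := by
  obtain ⟨U, d, h1, h2, h3, h4⟩ := real_diag B hB
  set Z := Uᵀ * Y * U with hZ
  have hZp : Z.PosSemidef := by
    have := hY.conjTranspose_mul_mul_same U
    simpa [hZ] using this
  have e1 : (B * Y).trace = ∑ i, d i * Z i i := by
    rw [h3, Matrix.mul_assoc, Matrix.mul_assoc, Matrix.trace_mul_comm, Matrix.mul_assoc, ← hZ]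
    simp [trace, diagonal_mul]
  have e2 : (Y * Y).trace = (Z * Z).trace := by
    have : Z * Z = Uᵀ * ((Y * Y) * U) := by
      calc Z * Z = Uᵀ * Y * (U * Uᵀ) * Y * U := by simp only [hZ, Matrix.mul_assoc]
        _ = _ := by rw [h1]; simp only [Matrix.mul_one, Matrix.mul_assoc]
    rw [this, Matrix.trace_mul_comm Uᵀ, Matrix.mul_assoc (Y * Y) U, h1, Matrix.mul_one]
  have e3 : ∑ i, Z i i ^ 2 ≤ (Z * Z).trace := by
    simp only [trace, diag_apply, mul_apply]
    apply Finset.sum_le_sum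
    intro i _
    have hs : ∀ j, Z i j * Z j i = Z i j ^ 2 := by
      intro j
      have := hZp.1.apply i j
      simp only [star_trivial] at this
      rw [this]; ring
    simp only [hs]
    exact Finset.single_le_sum (f := fun j => Z i j ^ 2) (fun j _ => sq_nonneg _)
      (Finset.mem_univ i)
  rw [h4, Multiset.map_map]
  change _ ≤ ∑ i, nsq (d i)
  have e4 : ∑ i, (-2 * (d i * Z i i) - Z i i ^ 2) ≤ ∑ i, nsq (d i) := by
    apply Finset.sum_le_sum
    intro i _
    have hz : 0 ≤ Z i i := hZp.diag_nonneg
    unfold nsq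
    rcases le_total (-d i) 0 with h | h
    · rw [max_eq_right h]; nlinarith [mul_nonneg (by linarith : 0 ≤ d i) hz]
    · rw [max_eq_left h]; nlinarith [sq_nonneg (d i + Z i i)]
  rw [Finset.sum_sub_distrib, ← Finset.mul_sum] at e4
  rw [e1, e2]; linarith

open Matrix in
lemma trace_vecMulVec_mul {V : Type*} [Fintype V] [DecidableEq V] (Y : Matrix V V ℝ)
    (x : V → ℝ) : (vecMulVec x x * Y).trace = x ⬝ᵥ (Y *ᵥ x) := by
  rw [vecMulVec_mul, trace_vecMulVec, dotProduct_comm, dotProduct_mulVec, dotProduct_comm,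
    dotProduct_comm]

open Matrix in
lemma diag_bound {V : Type*} [Fintype V] [DecidableEq V] (d x y : V → ℝ) (t s : ℝ)
    (ht : ∀ i, -t ≤ d i) (ht0 : 0 ≤ t) (hs0 : 0 ≤ s) (hs1 : s ≤ 1) (hx : ∑ i, x i ^ 2 ≤ 1) :
    ∑ i, nsq (d i) - 2 * t * (1 - s) - s ^ 2 * t ^ 2 ≤
      ((diagonal d + vecMulVec x x - vecMulVec y y).charpoly.roots.map nsq).sum := by
  have hB : (diagonal d + vecMulVec x x - vecMulVec y y).IsHermitian := by
    ext i j
    simp [vecMulVec_apply, diagonal_apply, mul_comm, eq_comm]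
    split_ifs with h <;> simp_all
  set ν : V → ℝ := fun i => max (-d i) 0 with hν
  have hν0 : ∀ i, 0 ≤ ν i := fun i => le_max_right _ _
  have hνt : ∀ i, ν i ≤ t := fun i => max_le (by linarith [ht i]) ht0
  have hνd : ∀ i, d i * ν i = - ν i ^ 2 := by
    intro i
    simp only [hν]
    rcases le_total (-d i) 0 with h | h
    · rw [max_eq_right h]; ring
    · rw [max_eq_left h]; ring
  set a := ∑ i, ν i * x i ^ 2 with ha
  set b := ∑ i, ν i ^ 2 * x i ^ 2 with hb
  have ha0 : 0 ≤ a := Finset.sum_nonneg fun i _ => mul_nonneg (hν0 i) (sq_nonneg _)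
  have hb0 : 0 ≤ b := Finset.sum_nonneg fun i _ => mul_nonneg (sq_nonneg _) (sq_nonneg _)
  have hbt : b ≤ t * a := by
    rw [ha, hb, Finset.mul_sum]
    apply Finset.sum_le_sum
    intro i _
    have : ν i * (ν i * x i ^ 2) ≤ t * (ν i * x i ^ 2) :=
      mul_le_mul_of_nonneg_right (hνt i) (mul_nonneg (hν0 i) (sq_nonneg _))
    linarith
  have hat : a ≤ t := by
    have : a ≤ t * ∑ i, x i ^ 2 := by
      rw [ha, Finset.mul_sum]
      exact Finset.sum_le_sum fun i _ => mul_le_mul_of_nonneg_right (hνt i) (sq_nonneg _)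
    nlinarith
  -- the coefficient
  obtain ⟨c, hc0, hca, hcb⟩ : ∃ c : ℝ, 0 ≤ c ∧ c * a ≤ 1 ∧
      2 * (a - c * a ^ 2) + c ^ 2 * b ^ 2 ≤ 2 * t * (1 - s) + s ^ 2 * t ^ 2 := by
    rcases ha0.eq_or_lt with h | h
    · refine ⟨0, le_rfl, by simp, ?_⟩
      rw [← h]
      nlinarith [mul_nonneg ht0 (sub_nonneg.2 hs1), sq_nonneg (s * t)]
    · refine ⟨s / a, by positivity, by rwa [div_mul_cancel₀ _ h.ne'], ?_⟩
      have h1 : s / a * a ^ 2 = s * a := by field_simp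
      have h2 : (s / a) ^ 2 * b ^ 2 ≤ s ^ 2 * t ^ 2 := by
        have : (s / a) * b ≤ s * t := by
          rw [div_mul_eq_mul_div, div_le_iff₀ h]; nlinarith
        rw [← mul_pow, ← mul_pow]
        exact pow_le_pow_left₀ (by positivity) this 2
      rw [h1]
      nlinarith [mul_nonneg (sub_nonneg.2 hat) (sub_nonneg.2 hs1)]
  set z : V → ℝ := fun i => ν i * x i with hz
  set Y : Matrix V V ℝ := diagonal ν - c • vecMulVec z z with hY
  have hYq : ∀ w : V → ℝ, w ⬝ᵥ (Y *ᵥ w) = ∑ i, ν i * w i ^ 2 - c * (∑ i, z i * w i) ^ 2 := by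
    intro w
    rw [hY, sub_mulVec, dotProduct_sub, smul_mulVec, vecMulVec_mulVec]
    simp only [dotProduct_smul, dotProduct, mulVec_diagonal]
    simp only [smul_eq_mul, Pi.smul_apply, MulOpposite.smul_eq_mul_unop, MulOpposite.unop_op]
    congr 1
    · exact Finset.sum_congr rfl fun i _ => by ring
    · rw [sq]
      congr 1
      simp only [← mul_assoc, ← Finset.sum_mul]
      congr 1
      rw [Finset.mul_sum]
      exact Finset.sum_congr rfl fun i _ => by ring
  have hYp : Y.PosSemidef := by
    apply Matrix.PosSemidef.of_dotProduct_mulVec_nonneg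
    · ext i j
      simp [hY, vecMulVec_apply, diagonal_apply, mul_comm, eq_comm]
      split_ifs with h <;> simp_all
    · intro w
      rw [star_trivial, hYq]
      have cs : (∑ i, z i * w i) ^ 2 ≤ a * ∑ i, ν i * w i ^ 2 := by
        rw [ha]
        apply Finset.sum_sq_le_sum_mul_sum_of_sq_le_mul
        · exact fun i _ => mul_nonneg (hν0 i) (sq_nonneg _)
        · exact fun i _ => mul_nonneg (hν0 i) (sq_nonneg _)
        · intro i _; simp only [hz]; exact le_of_eq (by ring)
      have hw : 0 ≤ ∑ i, ν i * w i ^ 2 :=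
        Finset.sum_nonneg fun i _ => mul_nonneg (hν0 i) (sq_nonneg _)
      nlinarith [mul_le_mul_of_nonneg_left cs hc0, mul_le_mul_of_nonneg_right hca hw]
  have key := lower_bound _ Y hB hYp
  refine le_trans ?_ key
  have hxx : x ⬝ᵥ (Y *ᵥ x) = a - c * a ^ 2 := by
    rw [hYq]
    have : ∑ i, z i * x i = a := Finset.sum_congr rfl fun i _ => by simp only [hz]; ring
    rw [this]
  have hyy : 0 ≤ y ⬝ᵥ (Y *ᵥ y) := by simpa using hYp.dotProduct_mulVec_nonneg y
  have hdY : (diagonal d * Y).trace = - ∑ i, ν i ^ 2 + c * ∑ i, ν i * z i ^ 2 := by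
    simp only [trace, diag_apply, diagonal_mul, hY, Matrix.sub_apply, diagonal_apply_eq, Matrix.smul_apply,
      vecMulVec_apply, smul_eq_mul]
    rw [Finset.mul_sum, ← Finset.sum_neg_distrib, ← Finset.sum_add_distrib]
    refine Finset.sum_congr rfl fun i _ => ?_
    simp only [hz]
    linear_combination (1 - c * ν i * x i ^ 2) * hνd i
  have hYY : (Y * Y).trace = ∑ i, ν i ^ 2 - 2 * c * ∑ i, ν i * z i ^ 2 + c ^ 2 * b ^ 2 := by
    have h1 : (diagonal ν * Y).trace = ∑ i, ν i ^ 2 - c * ∑ i, ν i * z i ^ 2 := by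
      simp only [trace, diag_apply, diagonal_mul, hY, Matrix.sub_apply, diagonal_apply_eq, Matrix.smul_apply,
        vecMulVec_apply, smul_eq_mul]
      rw [Finset.mul_sum, ← Finset.sum_sub_distrib]
      exact Finset.sum_congr rfl fun i _ => by ring
    have h2 : (vecMulVec z z * Y).trace = ∑ i, ν i * z i ^ 2 - c * b ^ 2 := by
      rw [trace_vecMulVec_mul, hYq]
      have : ∑ i, z i * z i = b := Finset.sum_congr rfl fun i _ => by simp only [hz]; ring
      rw [this]
    have h3 : Y * Y = diagonal ν * Y - c • (vecMulVec z z * Y) := by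
      conv_lhs => lhs; rw [hY]
      rw [Matrix.sub_mul, Matrix.smul_mul]
    rw [h3, trace_sub, trace_smul, h1, h2, smul_eq_mul]; ring
  have hf : ∑ i, nsq (d i) = ∑ i, ν i ^ 2 := rfl
  rw [Matrix.sub_mul, Matrix.add_mul, trace_sub, trace_add, trace_vecMulVec_mul,
    trace_vecMulVec_mul, hxx, hdY, hYY, hf]
  linarith

open Matrix in
lemma matrix_bound {V : Type*} [Fintype V] [DecidableEq V] (A : Matrix V V ℝ)
    (hA : A.IsHermitian) (x y : V → ℝ) (t s : ℝ)
    (ht : ∀ r ∈ A.charpoly.roots, -t ≤ r) (ht0 : 0 ≤ t) (hs0 : 0 ≤ s) (hs1 : s ≤ 1)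
    (hx : x ⬝ᵥ x ≤ 1) :
    (A.charpoly.roots.map nsq).sum - 2 * t * (1 - s) - s ^ 2 * t ^ 2 ≤
      ((A + vecMulVec x x - vecMulVec y y).charpoly.roots.map nsq).sum := by
  obtain ⟨U, d, h1, h2, h3, h4⟩ := real_diag A hA
  have hxx : ∑ i, (Uᵀ *ᵥ x) i ^ 2 ≤ 1 := by
    have : ∑ i, (Uᵀ *ᵥ x) i ^ 2 = x ⬝ᵥ x := by
      calc _ = (Uᵀ *ᵥ x) ⬝ᵥ (Uᵀ *ᵥ x) := Finset.sum_congr rfl fun i _ => sq _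
        _ = x ⬝ᵥ x := by
          rw [dotProduct_mulVec, vecMul_transpose, mulVec_mulVec, h1, one_mulVec]
    rw [this]; exact hx
  have key := diag_bound d (Uᵀ *ᵥ x) (Uᵀ *ᵥ y) t s
    (fun i => ht _ (by rw [h4]; exact Multiset.mem_map_of_mem _ (Finset.mem_univ i)))
    ht0 hs0 hs1 hxx
  have hv : ∀ w : V → ℝ, vecMulVec (Uᵀ *ᵥ w) (Uᵀ *ᵥ w) = Uᵀ * vecMulVec w w * U := by
    intro w
    rw [mul_vecMulVec, vecMulVec_mul, mulVec_transpose]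
  have hd : diagonal d = Uᵀ * A * U := by
    rw [h3]
    calc diagonal d = (Uᵀ * U) * diagonal d * (Uᵀ * U) := by rw [h2]; simp
      _ = _ := by simp only [Matrix.mul_assoc]
  have hc : (diagonal d + vecMulVec (Uᵀ *ᵥ x) (Uᵀ *ᵥ x) -
      vecMulVec (Uᵀ *ᵥ y) (Uᵀ *ᵥ y)).charpoly =
      (A + vecMulVec x x - vecMulVec y y).charpoly := by
    rw [hv, hv, hd, ← Matrix.add_mul, ← Matrix.mul_add, ← Matrix.sub_mul, ← Matrix.mul_sub,
      Matrix.mul_assoc, charpoly_mul_comm, Matrix.mul_assoc, h1, Matrix.mul_one]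
  rw [hc] at key
  have : (A.charpoly.roots.map nsq).sum = ∑ i, nsq (d i) := by
    rw [h4, Multiset.map_map]; rfl
  rw [this]; exact key

lemma adjMat_congr {V : Type*} [Fintype V] (G H : SimpleGraph V) (i j k l : V)
    (h : G.Adj i j ↔ H.Adj k l) : adjMat G i j = adjMat H k l := by
  simp only [adjMat, SimpleGraph.adjMatrix_apply]
  by_cases h' : H.Adj k l
  · rw [if_pos h', if_pos (h.2 h')]
  · rw [if_neg h', if_neg (fun h2 => h' (h.1 h2))]

lemma adjMat_pos {V : Type*} [Fintype V] (G : SimpleGraph V) (i j : V)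
    (h : G.Adj i j) : adjMat G i j = 1 := by
  simp [adjMat, SimpleGraph.adjMatrix_apply, h]

lemma adjMat_neg {V : Type*} [Fintype V] (G : SimpleGraph V) (i j : V)
    (h : ¬ G.Adj i j) : adjMat G i j = 0 := by
  simp [adjMat, SimpleGraph.adjMatrix_apply, h]

/-- Let `G` be a simple graph on `n` vertices, `e ∈ E(G)`, `H = G - e`,
with `lam` and `θ` the nonincreasing lists of eigenvalues of `A(G)` and `A(H)` (0-indexed,
so `θ (n-1)` is the smallest eigenvalue θₙ of `H`, and `θ (n-2) < 0` says that `H` has at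
least two negative eigenvalues). Then `s⁻(G) ≥ s⁻(H) - θₙ²` when `θₙ > -1`, and
`s⁻(G) ≥ s⁻(H) + 2θₙ + 1` when `θₙ ≤ -1`. -/
theorem negative_square_energy_edge_deletion {n : ℕ}
    (G H : SimpleGraph (Fin n)) (e : Sym2 (Fin n)) (he : e ∈ G.edgeSet)
    (hH : H = G.deleteEdges {e})
    (lam θ : ℕ → ℝ) (hlam_mono : Antitone lam) (hθ_mono : Antitone θ)
    (hlam : (adjMat G).charpoly.roots = (Multiset.range n).map lam)
    (hθ : (adjMat H).charpoly.roots = (Multiset.range n).map θ)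
    (hn : 2 ≤ n) (hneg : θ (n - 2) < 0) :
    (-1 < θ (n - 1) → sMinus G ≥ sMinus H - θ (n - 1) ^ 2) ∧
    (θ (n - 1) ≤ -1 → sMinus G ≥ sMinus H + 2 * θ (n - 1) + 1) := by
  obtain ⟨u, v⟩ := e
  have huv : G.Adj u v := he
  have hne : u ≠ v := huv.ne
  obtain ⟨k, hk⟩ : ∃ k : ℝ, k * k = 1 / 2 :=
    ⟨Real.sqrt (1 / 2), Real.mul_self_sqrt (by norm_num)⟩
  set x : Fin n → ℝ := fun i => k * ((if i = u then 1 else 0) + (if i = v then 1 else 0)) with hx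
  set y : Fin n → ℝ := fun i => k * ((if i = u then 1 else 0) - (if i = v then 1 else 0)) with hy
  have hherm : (adjMat H).IsHermitian := by
    ext i j
    exact adjMat_congr H H j i i j (H.adj_comm j i)
  have hAG : adjMat G = adjMat H + Matrix.vecMulVec x x - Matrix.vecMulVec y y := by
    ext i j
    have hadj : H.Adj i j ↔ G.Adj i j ∧ ¬ (i = u ∧ j = v ∨ i = v ∧ j = u) := by
      rw [hH, SimpleGraph.deleteEdges_adj]
      change _ ∧ ¬ (s(i, j) = s(u, v)) ↔ _
      rw [Sym2.eq_iff]
    have hform : x i * x j - y i * y j = (if i = u then 1 else 0) * (if j = v then 1 else 0)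
        + (if i = v then 1 else 0) * (if j = u then 1 else 0) := by
      simp only [hx, hy]
      linear_combination 2 * ((if i = u then 1 else 0) * (if j = v then 1 else 0)
        + (if i = v then 1 else 0) * (if j = u then 1 else 0)) * hk
    rw [Matrix.sub_apply, Matrix.add_apply, Matrix.vecMulVec_apply, Matrix.vecMulVec_apply,
      add_sub_assoc, hform]
    by_cases h1 : i = u ∧ j = v
    · obtain ⟨rfl, rfl⟩ := h1
      rw [adjMat_pos G _ _ huv, adjMat_neg H _ _ (fun h => (hadj.1 h).2 (Or.inl ⟨rfl, rfl⟩))]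
      simp [hne]
    · by_cases h2 : i = v ∧ j = u
      · obtain ⟨rfl, rfl⟩ := h2
        rw [adjMat_pos G _ _ huv.symm,
          adjMat_neg H _ _ (fun h => (hadj.1 h).2 (Or.inr ⟨rfl, rfl⟩))]
        simp [hne.symm]
      · have e1 : ((if i = u then 1 else 0) * (if j = v then 1 else 0) : ℝ) = 0 := by
          by_cases h : i = u <;> by_cases h' : j = v <;> simp_all
        have e2 : ((if i = v then 1 else 0) * (if j = u then 1 else 0) : ℝ) = 0 := by
          by_cases h : i = v <;> by_cases h' : j = u <;> simp_all
        rw [e1, e2, adjMat_congr G H i j i j (by rw [hadj]; tauto)]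
        ring
  have hxx : dotProduct x x ≤ 1 := by
    have : ∀ i, x i * x i = (1 / 2) * ((if i = u then 1 else 0) + (if i = v then 1 else 0)) := by
      intro i
      have hz : ((if i = u then 1 else 0) * (if i = v then 1 else 0) : ℝ) = 0 := by
        by_cases h : i = u
        · rw [if_neg (fun h' : i = v => hne (h.symm.trans h')), mul_zero]
        · rw [if_neg h, zero_mul]
      have hu : ((if i = u then 1 else 0) * (if i = u then 1 else 0) : ℝ)
        = if i = u then 1 else 0 := by split_ifs <;> simp
      have hv : ((if i = v then 1 else 0) * (if i = v then 1 else 0) : ℝ)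
        = if i = v then 1 else 0 := by split_ifs <;> simp
      simp only [hx]
      linear_combination ((if i = u then 1 else 0) + (if i = v then 1 else 0)) ^ 2 * hk
        + (1 / 2) * hu + (1 / 2) * hv + hz
    simp only [dotProduct, this]
    rw [← Finset.mul_sum, Finset.sum_add_distrib]
    norm_num [Finset.sum_ite_eq']
  have hθneg : θ (n - 1) < 0 := lt_of_le_of_lt (hθ_mono (by omega)) hneg
  have hroots : ∀ r ∈ (adjMat H).charpoly.roots, -(-θ (n - 1)) ≤ r := by
    intro r hr
    rw [hθ, Multiset.mem_map] at hr
    obtain ⟨i, hi, rfl⟩ := hr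
    rw [Multiset.mem_range] at hi
    rw [neg_neg]
    exact hθ_mono (by omega)
  have key := fun s h0 h1 => matrix_bound (adjMat H) hherm x y (-θ (n - 1)) s hroots
    (by linarith) h0 h1 hxx
  rw [← hAG] at key
  simp only [sMinus, filter_sum_eq]
  constructor
  · intro _
    have := key 1 zero_le_one le_rfl
    nlinarith
  · intro h
    have hne0 : θ (n - 1) ≠ 0 := hθneg.ne
    have hpos : 0 < -θ (n - 1) := by linarith
    have := key (1 / (-θ (n - 1))) (by positivity) (by rw [div_le_one hpos]; linarith)
    have e1 : 2 * -θ (n - 1) * (1 - 1 / -θ (n - 1)) = -2 * θ (n - 1) - 2 := by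
      field_simp
      ring
    have e2 : (1 / -θ (n - 1)) ^ 2 * (-θ (n - 1)) ^ 2 = 1 := by
      field_simp
    rw [e1, e2] at this
    linarith
end

section
/- For every integer n ≥ 3, E_1^+(S̄_{n,n}) > E_1^+((S̄_{n,n})⁺); equivalently, √((n−1)² + 1/4) − (n−1) + √(n − 3/4) − √(n−1) > 0 for all n ≥ 3, where the left-hand side equals the difference between the sum of the positive adjacency eigenvalues of S̄_{n,n} and that of (S̄_{n,n})⁺. -/
open Polynomial

/-- The double star `S_{n,n}`: two stars `K_{1,n-1}` with centers `Sum.inl none` and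
`Sum.inr none`, joined by an edge between the two centers. It has `2n` vertices when `n ≥ 1`. -/
def doubleStar (n : ℕ) : SimpleGraph (Option (Fin (n - 1)) ⊕ Option (Fin (n - 1))) :=
  SimpleGraph.fromRel (fun a b =>
    (a = Sum.inl none ∧ ∃ i, b = Sum.inl (some i)) ∨
    (a = Sum.inr none ∧ ∃ i, b = Sum.inr (some i)) ∨
    (a = Sum.inl none ∧ b = Sum.inr none))

/-- `(S̄_{n,n})⁺`: the complement of the double star with the edge `v₁v₂` between the two
centers added. -/
def doubleStarCompPlus (n : ℕ) :
    SimpleGraph (Option (Fin (n - 1)) ⊕ Option (Fin (n - 1))) :=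
  (doubleStar n)ᶜ ⊔ SimpleGraph.fromEdgeSet {s(Sum.inl none, Sum.inr none)}

open Matrix in
/-- Quotient matrix of `A + 1`, with parameter `c` for the edge between the centers. -/
def quotMat (c : ℝ) : Matrix (Fin 4) (Fin 4) ℝ :=
  !![1, 0, c, 1; 0, 1, 1, 1; c, 1, 1, 0; 1, 1, 0, 1]

/-- The class of a vertex. -/
def vcls {m : ℕ} : Option (Fin m) ⊕ Option (Fin m) → Fin 4
  | Sum.inl none => 0
  | Sum.inl (some _) => 1
  | Sum.inr none => 2
  | Sum.inr (some _) => 3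

open Classical in
lemma adjMat_apply' {V : Type*} [Fintype V] (G : SimpleGraph V) (a b : V) :
    adjMat G a b = if G.Adj a b then 1 else 0 := by
  simp [adjMat, SimpleGraph.adjMatrix_apply]

lemma adjMat_comp (n : ℕ) :
    adjMat ((doubleStar n)ᶜ) = (quotMat 0).submatrix vcls vcls - Matrix.scalar _ 1 := by
  ext a b
  rw [adjMat_apply']
  rcases a with (_ | a) | (_ | a) <;> rcases b with (_ | b) | (_ | b) <;>
    simp [doubleStar, quotMat, vcls, Matrix.one_apply] <;>
    (try split_ifs) <;> simp_all

lemma adjMat_plus (n : ℕ) :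
    adjMat (doubleStarCompPlus n) = (quotMat 1).submatrix vcls vcls - Matrix.scalar _ 1 := by
  ext a b
  rw [adjMat_apply']
  rcases a with (_ | a) | (_ | a) <;> rcases b with (_ | b) | (_ | b) <;>
    simp [doubleStar, doubleStarCompPlus, quotMat, vcls,
      Matrix.one_apply] <;>
    (try split_ifs) <;> simp_all

lemma charpoly_quot (m : ℕ) (hm : 1 ≤ m) (c s t u v : ℝ)
    (h1 : s + t = 2 * m - 1 + c) (h2 : s * t = c * (2 * m - 1) - m)
    (h3 : u + v = -(1 + c)) (h4 : u * v = c - m) :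
    ((quotMat c).submatrix vcls vcls -
      Matrix.scalar (Option (Fin m) ⊕ Option (Fin m)) 1).charpoly =
      (X - C (-1)) ^ (2 * m - 2) * ((X - C s) * (X - C t) * ((X - C u) * (X - C v))) := by
  have hfac : (quotMat c).submatrix (vcls (m := m)) vcls =
      ((quotMat c).submatrix (vcls (m := m)) id) *
        ((1 : Matrix (Fin 4) (Fin 4) ℝ).submatrix id (vcls (m := m))) := by
    ext a b
    simp [Matrix.mul_apply, Matrix.one_apply]
  have hWU : ((1 : Matrix (Fin 4) (Fin 4) ℝ).submatrix id (vcls (m := m))) *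
      ((quotMat c).submatrix (vcls (m := m)) id) =
      !![1, 0, c, 1; 0, (m : ℝ), m, m; c, 1, 1, 0; m, m, 0, m] := by
    ext a b
    fin_cases a <;> fin_cases b <;>
      simp [Matrix.mul_apply, Matrix.one_apply, Fintype.sum_sum_type, Fintype.sum_option, vcls,
        quotMat]
  rw [Matrix.charpoly_sub_scalar, hfac, Matrix.charpoly_mul_comm_of_le _ _ (by simp; omega), hWU]
  have hc : Fintype.card (Option (Fin m) ⊕ Option (Fin m)) - Fintype.card (Fin 4) = 2 * m - 2 := by
    simp; omega
  rw [hc]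
  apply Polynomial.funext
  intro x
  rw [Polynomial.eval_comp, Polynomial.eval_mul, Matrix.eval_charpoly]
  simp only [eval_mul, eval_pow, eval_add, eval_sub, eval_X, eval_C, sub_neg_eq_add]
  congr 1
  have e1 : (x - s) * (x - t) = x ^ 2 - (2 * m - 1 + c) * x + (c * (2 * m - 1) - m) := by
    rw [← h1, ← h2]; ring
  have e2 : (x - u) * (x - v) = x ^ 2 + (1 + c) * x + (c - m) := by
    have : (1 + c) = -(u + v) := by rw [h3]; ring
    rw [this, ← h4]; ring
  rw [e1, e2]
  simp [Matrix.det_succ_row_zero, Fin.sum_univ_succ, Fin.succAbove, Matrix.scalar_apply]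
  ring

lemma roots_quot (k : ℕ) (s t u v : ℝ) :
    ((X - C (-1)) ^ k * ((X - C s) * (X - C t) * ((X - C u) * (X - C v))) : ℝ[X]).roots =
      Multiset.replicate k (-1) + ({s} + {t} + ({u} + {v})) := by
  have h (a : ℝ) : (X - C a) ≠ 0 := X_sub_C_ne_zero a
  rw [roots_mul, roots_mul, roots_mul, roots_mul, roots_pow]
  · simp only [roots_X_sub_C, Multiset.nsmul_singleton]
  all_goals
    simp only [ne_eq, mul_eq_zero, pow_eq_zero_iff', not_or, not_and_or]
    have h' : (X + 1 : ℝ[X]) ≠ 0 := by simpa using h (-1)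
    simp [h, h']

lemma posSum_quot (k : ℕ) (s t u v : ℝ) :
    (((Multiset.replicate k (-1 : ℝ) + ({s} + {t} + ({u} + {v}))).filter
      (fun x : ℝ => 0 < x)).map (fun x : ℝ => x ^ (1 : ℝ))).sum =
      max s 0 + max t 0 + (max u 0 + max v 0) := by
  have h0 : (Multiset.replicate k (-1 : ℝ)).filter (fun x : ℝ => 0 < x) = 0 := by
    rw [Multiset.filter_eq_nil]
    intro a ha
    rw [Multiset.eq_of_mem_replicate ha]; norm_num
  have h1 (a : ℝ) : ((Multiset.filter (fun x : ℝ => 0 < x) {a}).map id).sum = max a 0 := by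
    rw [Multiset.filter_singleton]
    split_ifs with h
    · simp [h.le]
    · simp [not_lt.mp h]
  have hid : (fun x : ℝ => x ^ (1 : ℝ)) = id := by
    funext x; simp
  rw [hid]
  simp only [Multiset.filter_add, Multiset.map_add, Multiset.sum_add, h0, h1]
  simp

/-- For every `n ≥ 3`, `E_1^+(S̄_{n,n}) > E_1^+((S̄_{n,n})⁺)`; moreover the
difference of the two positive 1-energies equals
`√((n-1)² + 1/4) - (n-1) + √(n - 3/4) - √(n-1)`, which is positive for all `n ≥ 3`. -/
theorem posEnergy_one_doubleStar (n : ℕ) (hn : 3 ≤ n) :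
    posEnergy ((doubleStar n)ᶜ) 1 > posEnergy (doubleStarCompPlus n) 1 ∧
    posEnergy ((doubleStar n)ᶜ) 1 - posEnergy (doubleStarCompPlus n) 1 =
      Real.sqrt (((n : ℝ) - 1) ^ 2 + 1 / 4) - ((n : ℝ) - 1) +
        Real.sqrt ((n : ℝ) - 3 / 4) - Real.sqrt ((n : ℝ) - 1) ∧
    Real.sqrt (((n : ℝ) - 1) ^ 2 + 1 / 4) - ((n : ℝ) - 1) +
        Real.sqrt ((n : ℝ) - 3 / 4) - Real.sqrt ((n : ℝ) - 1) > 0 := by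
  obtain ⟨m, rfl⟩ : ∃ m, n = m + 1 := ⟨n - 1, by omega⟩
  have hm2 : (2 : ℝ) ≤ m := by exact_mod_cast (by omega : 2 ≤ m)
  have hcast : ((m + 1 - 1 : ℕ) : ℝ) = m := by rw [Nat.add_sub_cancel]
  have c1 : ((m + 1 : ℕ) : ℝ) - 1 = m := by push_cast; ring
  have c2 : ((m + 1 : ℕ) : ℝ) - 3 / 4 = m + 1 / 4 := by push_cast; ring
  rw [c1, c2]
  have q1 : Real.sqrt ((m : ℝ) ^ 2 + 1 / 4) ^ 2 = (m : ℝ) ^ 2 + 1 / 4 :=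
    Real.sq_sqrt (by positivity)
  have q2 : Real.sqrt ((m : ℝ) + 1 / 4) ^ 2 = (m : ℝ) + 1 / 4 := Real.sq_sqrt (by positivity)
  have q3 : Real.sqrt (m : ℝ) ^ 2 = (m : ℝ) := Real.sq_sqrt (by positivity)
  have q4 : Real.sqrt ((m : ℝ) ^ 2 - m + 1) ^ 2 = (m : ℝ) ^ 2 - m + 1 :=
    Real.sq_sqrt (by nlinarith)
  have p1 : (m : ℝ) < Real.sqrt ((m : ℝ) ^ 2 + 1 / 4) :=
    Real.lt_sqrt_of_sq_lt (by linarith)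
  have p2 : Real.sqrt (m : ℝ) < Real.sqrt ((m : ℝ) + 1 / 4) :=
    Real.sqrt_lt_sqrt (by positivity) (by linarith)
  have p3 : 1 < Real.sqrt (m : ℝ) := Real.lt_sqrt_of_sq_lt (by linarith)
  have p4 : Real.sqrt ((m : ℝ) ^ 2 - m + 1) < m := by
    rw [Real.sqrt_lt' (by linarith)]; linarith
  have p5 := Real.sqrt_nonneg ((m : ℝ) ^ 2 - m + 1)
  have E1 : posEnergy ((doubleStar (m + 1))ᶜ) 1 =
      m - 1 + Real.sqrt ((m : ℝ) ^ 2 + 1 / 4) + Real.sqrt ((m : ℝ) + 1 / 4) := by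
    have h := charpoly_quot (m + 1 - 1) (by omega) 0 (m - 1 / 2 + Real.sqrt ((m : ℝ) ^ 2 + 1 / 4))
      (m - 1 / 2 - Real.sqrt ((m : ℝ) ^ 2 + 1 / 4))
      (-1 / 2 + Real.sqrt ((m : ℝ) + 1 / 4)) (-1 / 2 - Real.sqrt ((m : ℝ) + 1 / 4))
      (by rw [hcast]; ring) (by rw [hcast]; linear_combination -q1) (by ring)
      (by rw [hcast]; linear_combination -q2)
    unfold posEnergy
    rw [adjMat_comp]
    rw [h, roots_quot, posSum_quot, max_eq_left, max_eq_right, max_eq_left, max_eq_right]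
    · ring
    all_goals linarith
  have E2 : posEnergy (doubleStarCompPlus (m + 1)) 1 = 2 * m - 1 + Real.sqrt (m : ℝ) := by
    have h := charpoly_quot (m + 1 - 1) (by omega) 1 (m + Real.sqrt ((m : ℝ) ^ 2 - m + 1))
      (m - Real.sqrt ((m : ℝ) ^ 2 - m + 1))
      (-1 + Real.sqrt (m : ℝ)) (-1 - Real.sqrt (m : ℝ))
      (by rw [hcast]; ring) (by rw [hcast]; linear_combination -q4) (by ring)
      (by rw [hcast]; linear_combination -q3)
    unfold posEnergy
    rw [adjMat_plus]
    rw [h, roots_quot, posSum_quot, max_eq_left, max_eq_left, max_eq_left, max_eq_right]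
    · ring
    all_goals linarith
  rw [E1, E2]
  refine ⟨by linarith, by ring, by linarith⟩
end
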